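/- arXiv:1501.04548 — 2 statements merged into one kernel-verified Lean document; each statement's English description precedes it below -/
import Mathlib

section
/- Let f : ℝ → ℝ be bounded and continuous with ∫ f dπ = 0, and let G(y) = E(y)^{−1}·∫_{−∞}^y (2 f(u)/σ₂(u)²) E(u) du. Then G is bounded on ℝ and moreover decays at rate 1/|y|: there exists a constant C > 0 such that |G(y)| ≤ C/(1 + |y|) for all y ∈ ℝ. -/
open MeasureTheory

noncomputable section

/-- `E(y) = exp(∫₀^y 2(m - z)/σ₂(z)² dz)`. -/
def Efun (m : ℝ) (σ₂ : ℝ → ℝ) (y : ℝ) : ℝ :=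
  Real.exp (∫ z in (0:ℝ)..y, 2 * (m - z) / (σ₂ z) ^ 2)

/-- The normalizing constant `Z = ∫_ℝ E(y)/σ₂(y)² dy`. -/
def Zconst (m : ℝ) (σ₂ : ℝ → ℝ) : ℝ :=
  ∫ y : ℝ, Efun m σ₂ y / (σ₂ y) ^ 2

/-- The invariant measure `π` on `ℝ` with density `p(y) = Z⁻¹·E(y)/σ₂(y)²`
with respect to Lebesgue measure. -/
def pimeas (m : ℝ) (σ₂ : ℝ → ℝ) : Measure ℝ :=
  volume.withDensity fun y => ENNReal.ofReal ((Zconst m σ₂)⁻¹ * (Efun m σ₂ y / (σ₂ y) ^ 2))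

end

/-- A nonnegative function with nonpositive derivative on `(a, ∞)` has integrable derivative there,
and the integral of the negated derivative is at most the value at `a`. -/
theorem integrableOn_deriv_and_integral_neg_le_of_nonneg {g g' : ℝ → ℝ} {a : ℝ}
    (hg : ∀ x, 0 ≤ g x) (hderiv : ∀ x, HasDerivAt g (g' x) x) (hneg : ∀ x ∈ Set.Ioi a, g' x ≤ 0) :
    IntegrableOn g' (Set.Ioi a) ∧ ∫ x in Set.Ioi a, -g' x ≤ g a := by
  have hanti : AntitoneOn g (Set.Ici a) :=
    antitoneOn_of_hasDerivWithinAt_nonpos (convex_Ici a)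
      (fun x _ => (hderiv x).continuousAt.continuousWithinAt)
      (fun x _ => (hderiv x).hasDerivWithinAt) (by simpa using hneg)
  have hanti' : Antitone fun x => g (max a x) := fun x y hxy =>
    hanti (Set.mem_Ici.2 (le_max_left _ _)) (Set.mem_Ici.2 (le_max_left _ _)) (max_le_max le_rfl hxy)
  have hlim := tendsto_atTop_ciInf hanti' ⟨0, by rintro _ ⟨x, rfl⟩; exact hg _⟩
  set l := ⨅ x, g (max a x)
  have hl : 0 ≤ l := le_ciInf fun x => hg _
  have hlim' : Filter.Tendsto g Filter.atTop (nhds l) := by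
    refine hlim.congr' ?_
    filter_upwards [Filter.eventually_ge_atTop a] with x hx
    rw [max_eq_right hx]
  refine ⟨integrableOn_Ioi_deriv_of_nonpos' (fun x _ => hderiv x) hneg hlim', ?_⟩
  rw [integral_neg, integral_Ioi_of_hasDerivAt_of_nonpos' (fun x _ => hderiv x) hneg hlim']
  linarith

/-- Right tail estimate for a function dominated by `w`, where `E' = 2 (m - ·) w`. -/
theorem integrableOn_Ioi_and_abs_integral_le {m K y : ℝ} {E w h : ℝ → ℝ} (hE : ∀ x, 0 ≤ E x)
    (hderiv : ∀ x, HasDerivAt E (2 * (m - x) * w x) x) (hw : ∀ x, 0 ≤ w x)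
    (hh : Continuous h) (hK : 0 ≤ K) (hhw : ∀ x, |h x| ≤ K * w x) (hy : m < y) :
    IntegrableOn h (Set.Ioi y) ∧ |∫ x in Set.Ioi y, h x| ≤ K / (2 * (y - m)) * E y := by
  have hym : 0 < 2 * (y - m) := by linarith
  obtain ⟨hint, hle⟩ := integrableOn_deriv_and_integral_neg_le_of_nonneg (a := y) hE hderiv
    (fun x hx => mul_nonpos_of_nonpos_of_nonneg (by linarith [Set.mem_Ioi.1 hx]) (hw x))
  have hdom : ∀ x ∈ Set.Ioi y, ‖h x‖ ≤ K / (2 * (y - m)) * -(2 * (m - x) * w x) := by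
    intro x hx
    have hx' : y < x := hx
    refine (hhw x).trans ?_
    rw [div_mul_eq_mul_div, le_div_iff₀ hym]
    have := mul_le_mul_of_nonneg_left (show 2 * (y - m) ≤ 2 * (x - m) by linarith)
      (mul_nonneg hK (hw x))
    linarith
  have hint' : IntegrableOn (fun x => K / (2 * (y - m)) * -(2 * (m - x) * w x)) (Set.Ioi y) :=
    hint.neg.const_mul _
  have hdom' := (ae_restrict_iff' (μ := volume) measurableSet_Ioi).2
    (Filter.Eventually.of_forall hdom)
  refine ⟨hint'.mono' hh.aestronglyMeasurable hdom', ?_⟩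
  calc |∫ x in Set.Ioi y, h x| ≤ ∫ x in Set.Ioi y, K / (2 * (y - m)) * -(2 * (m - x) * w x) :=
        norm_integral_le_of_norm_le hint' hdom'
    _ = K / (2 * (y - m)) * ∫ x in Set.Ioi y, -(2 * (m - x) * w x) := integral_const_mul _ _
    _ ≤ K / (2 * (y - m)) * E y := by gcongr

/-- Left tail estimate for a function dominated by `w`, where `E' = 2 (m - ·) w`. -/
theorem integrableOn_Iic_and_abs_integral_le {m K y : ℝ} {E w h : ℝ → ℝ} (hE : ∀ x, 0 ≤ E x)
    (hderiv : ∀ x, HasDerivAt E (2 * (m - x) * w x) x) (hw : ∀ x, 0 ≤ w x)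
    (hh : Continuous h) (hK : 0 ≤ K) (hhw : ∀ x, |h x| ≤ K * w x) (hy : y < m) :
    IntegrableOn h (Set.Iic y) ∧ |∫ x in Set.Iic y, h x| ≤ K / (2 * (m - y)) * E y := by
  have hderiv' : ∀ x, HasDerivAt (fun x => E (-x)) (2 * (-m - x) * w (-x)) x := fun x =>
    ((hderiv (-x)).scomp x (hasDerivAt_neg x)).congr_deriv (by simp only [smul_eq_mul]; ring)
  obtain ⟨hint, hle⟩ := integrableOn_Ioi_and_abs_integral_le (y := -y) (h := fun x => h (-x))
    (fun x => hE (-x)) hderiv' (fun x => hw (-x)) (hh.comp continuous_neg) hK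
    (fun x => hhw (-x)) (neg_lt_neg hy)
  rw [integral_comp_neg_Ioi, neg_neg, show -y - -m = m - y by ring] at hle
  refine ⟨?_, hle⟩
  rw [integrableOn_Iic_iff_integrableOn_Iio]
  simpa using hint.comp_neg_Iio

theorem integrable_of_abs_le_mul {m K : ℝ} {E w h : ℝ → ℝ} (hE : ∀ x, 0 ≤ E x)
    (hderiv : ∀ x, HasDerivAt E (2 * (m - x) * w x) x) (hw : ∀ x, 0 ≤ w x)
    (hh : Continuous h) (hK : 0 ≤ K) (hhw : ∀ x, |h x| ≤ K * w x) : Integrable h := by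
  have hR := (integrableOn_Ioi_and_abs_integral_le hE hderiv hw hh hK hhw (lt_add_one m)).1
  have hL := (integrableOn_Iic_and_abs_integral_le hE hderiv hw hh hK hhw (sub_one_lt m)).1
  have hM : IntegrableOn h (Set.Icc (m - 1) (m + 1)) := hh.integrableOn_Icc
  rw [← integrableOn_univ]
  refine ((hL.union hM).union hR).mono_set fun x _ => ?_
  simp only [Set.mem_union, Set.mem_Iic, Set.mem_Icc, Set.mem_Ioi]
  grind

theorem hasDerivAt_Efun {σ₂ : ℝ → ℝ} (hσ₂c : Continuous σ₂) (hpos : ∀ y, 0 < σ₂ y) (m y : ℝ) :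
    HasDerivAt (Efun m σ₂) (2 * (m - y) * (Efun m σ₂ y / σ₂ y ^ 2)) y := by
  have hc : Continuous fun z => 2 * (m - z) / σ₂ z ^ 2 :=
    Continuous.div (by fun_prop) (by fun_prop) fun z => (pow_pos (hpos z) 2).ne'
  exact ((hc.integral_hasStrictDerivAt 0 y).hasDerivAt.exp).congr_deriv (by simp only [Efun]; ring)

/-- A function centered for `pimeas` is centered for the unnormalized density. -/
theorem integral_mul_Efun_div_eq_zero {m : ℝ} {σ₂ f : ℝ → ℝ} (hσ₂c : Continuous σ₂)
    (hpos : ∀ y, 0 < σ₂ y) (hcent : ∫ y, f y ∂(pimeas m σ₂) = 0) :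
    ∫ y, f y * (Efun m σ₂ y / σ₂ y ^ 2) = 0 := by
  have hderiv := hasDerivAt_Efun hσ₂c hpos m
  have hEpos : ∀ y, 0 < Efun m σ₂ y := fun y => Real.exp_pos _
  have hwpos : ∀ y, 0 < Efun m σ₂ y / σ₂ y ^ 2 := fun y => div_pos (hEpos y) (pow_pos (hpos y) 2)
  have hEc : Continuous (Efun m σ₂) :=
    continuous_iff_continuousAt.2 fun y => (hderiv y).continuousAt
  have hwc : Continuous fun y => Efun m σ₂ y / σ₂ y ^ 2 :=
    hEc.div (by fun_prop) fun y => (pow_pos (hpos y) 2).ne'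
  have hwint : Integrable fun y => Efun m σ₂ y / σ₂ y ^ 2 :=
    integrable_of_abs_le_mul (fun y => (hEpos y).le) hderiv (fun y => (hwpos y).le) hwc zero_le_one
      fun y => by rw [abs_of_pos (hwpos y), one_mul]
  have hZ : 0 < Zconst m σ₂ := integral_pos_of_integrable_nonneg_nonzero hwc hwint
    (fun y => (hwpos y).le) (hwpos 0).ne'
  rw [pimeas, integral_withDensity_eq_integral_toReal_smul
    (hwc.const_mul _).measurable.ennreal_ofReal
    (Filter.Eventually.of_forall fun y => ENNReal.ofReal_lt_top)] at hcent
  have heq : ∀ y, (ENNReal.ofReal ((Zconst m σ₂)⁻¹ * (Efun m σ₂ y / σ₂ y ^ 2))).toReal • f y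
      = (Zconst m σ₂)⁻¹ * (f y * (Efun m σ₂ y / σ₂ y ^ 2)) := fun y => by
    rw [ENNReal.toReal_ofReal (mul_pos (inv_pos.2 hZ) (hwpos y)).le, smul_eq_mul]
    ring
  simp only [heq, integral_const_mul] at hcent
  exact (mul_eq_zero.1 hcent).resolve_left (inv_pos.2 hZ).ne'

/-- if `f` is bounded continuous and centered w.r.t. `π`, then
`G(y) = E(y)⁻¹ ∫_{-∞}^y (2f(u)/σ₂(u)²)E(u) du` is bounded, and moreover decays
like `1/|y|`: there is `C > 0` with `|G(y)| ≤ C/(1 + |y|)` for all `y`. -/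
theorem G_bounded_and_decays
    (m c₂ C₂ : ℝ) (σ₂ : ℝ → ℝ) (hσ₂c : Continuous σ₂)
    (hc₂ : 0 < c₂) (hσ₂ : ∀ y, c₂ ≤ σ₂ y ∧ σ₂ y ≤ C₂)
    (f : ℝ → ℝ) (hfc : Continuous f) (hfb : ∃ M, ∀ y, |f y| ≤ M)
    (hcent : ∫ y, f y ∂(pimeas m σ₂) = 0)
    (G : ℝ → ℝ)
    (hG : ∀ y : ℝ, G y
      = (Efun m σ₂ y)⁻¹ * ∫ u in Set.Iic y, 2 * f u / (σ₂ u) ^ 2 * Efun m σ₂ u) :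
    (∃ M : ℝ, ∀ y : ℝ, |G y| ≤ M) ∧
    ∃ C : ℝ, 0 < C ∧ ∀ y : ℝ, |G y| ≤ C / (1 + |y|) := by
  have hpos : ∀ y, 0 < σ₂ y := fun y => hc₂.trans_le (hσ₂ y).1
  have hderiv := hasDerivAt_Efun hσ₂c hpos m
  have hEpos : ∀ y, 0 < Efun m σ₂ y := fun y => Real.exp_pos _
  have hwnn : ∀ y, 0 ≤ Efun m σ₂ y / σ₂ y ^ 2 :=
    fun y => (div_pos (hEpos y) (pow_pos (hpos y) 2)).le
  have hEc : Continuous (Efun m σ₂) :=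
    continuous_iff_continuousAt.2 fun y => (hderiv y).continuousAt
  obtain ⟨M, hM⟩ := hfb
  have hM0 : 0 ≤ M := (abs_nonneg _).trans (hM 0)
  set h : ℝ → ℝ := fun u => 2 * f u / σ₂ u ^ 2 * Efun m σ₂ u with h_def
  have hhc : Continuous h :=
    Continuous.mul (Continuous.div (by fun_prop) (by fun_prop) fun y => (pow_pos (hpos y) 2).ne') hEc
  have hheq : ∀ u, h u = 2 * (f u * (Efun m σ₂ u / σ₂ u ^ 2)) := fun u => by
    simp only [h_def]; ring
  have hhw : ∀ u, |h u| ≤ 2 * M * (Efun m σ₂ u / σ₂ u ^ 2) := fun u => by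
    rw [hheq, abs_mul, abs_mul, abs_of_nonneg (hwnn u), abs_two, mul_assoc]
    have := mul_le_mul_of_nonneg_right (hM u) (hwnn u)
    linarith
  have hint : Integrable h :=
    integrable_of_abs_le_mul (fun y => (hEpos y).le) hderiv hwnn hhc (by positivity) hhw
  have hzero : ∫ u, h u = 0 := by
    simp only [hheq, integral_const_mul, integral_mul_Efun_div_eq_zero hσ₂c hpos hcent, mul_zero]
  have habs : ∀ y, |G y| = (Efun m σ₂ y)⁻¹ * |∫ u in Set.Iic y, h u| := fun y => by
    rw [hG, abs_mul, abs_of_pos (inv_pos.2 (hEpos y))]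
  have hfar : ∀ y, y ≠ m → |G y| ≤ M / |y - m| := by
    intro y hy
    rw [habs, inv_mul_le_iff₀ (hEpos y)]
    rcases lt_or_gt_of_ne hy with hy | hy
    · refine ((integrableOn_Iic_and_abs_integral_le (fun y => (hEpos y).le) hderiv hwnn hhc
        (by positivity) hhw hy).2).trans_eq ?_
      rw [abs_of_neg (sub_neg.2 hy), neg_sub, mul_div_mul_left _ _ two_ne_zero, mul_comm]
    · have hsplit : ∫ u in Set.Iic y, h u = -∫ u in Set.Ioi y, h u := by
        have := integral_add_compl (measurableSet_Iic (a := y)) hint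
        rw [Set.compl_Iic, hzero] at this
        linarith
      rw [hsplit, abs_neg]
      refine ((integrableOn_Ioi_and_abs_integral_le (fun y => (hEpos y).le) hderiv hwnn hhc
        (by positivity) hhw hy).2).trans_eq ?_
      rw [abs_of_pos (sub_pos.2 hy), mul_div_mul_left _ _ two_ne_zero, mul_comm]
  obtain ⟨B, hB⟩ := (isCompact_Icc (a := m - 1) (b := m + 1)).exists_bound_of_continuousOn
    (hEc.inv₀ fun y => (hEpos y).ne').continuousOn
  have hB0 : 0 ≤ B := (norm_nonneg _).trans (hB m ⟨by linarith, by linarith⟩)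
  have hI0 : 0 ≤ ∫ u, |h u| := integral_nonneg fun u => abs_nonneg _
  have hnear : ∀ y, |y - m| ≤ 1 → |G y| ≤ B * ∫ u, |h u| := by
    intro y hy
    rw [habs]
    have hy' := abs_le.1 hy
    refine mul_le_mul ((le_abs_self _).trans (hB y ⟨by linarith, by linarith⟩)) ?_ (abs_nonneg _) hB0
    exact (abs_integral_le_integral_abs).trans (setIntegral_le_integral hint.abs
      (Filter.Eventually.of_forall fun u => abs_nonneg _))
  have hdecay : ∃ C : ℝ, 0 < C ∧ ∀ y : ℝ, |G y| ≤ C / (1 + |y|) := by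
    refine ⟨(M + B * (∫ u, |h u|) + 1) * (2 + |m|), by positivity, fun y => ?_⟩
    rw [le_div_iff₀ (by positivity)]
    have htri : |y| ≤ |y - m| + |m| := by simpa using abs_add_le (y - m) m
    have hBI : 0 ≤ B * ∫ u, |h u| := mul_nonneg hB0 hI0
    have hm0 := abs_nonneg m
    rcases le_or_gt |y - m| 1 with hy | hy
    · exact mul_le_mul ((hnear y hy).trans (by linarith)) (by linarith) (by positivity)
        (by positivity)
    · have hy0 : y ≠ m := by rintro rfl; simp at hy; linarith
      have h1 := (le_div_iff₀ (by linarith)).1 (hfar y hy0)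
      calc |G y| * (1 + |y|) ≤ |G y| * (|y - m| * (2 + |m|)) := by
            gcongr
            nlinarith
        _ = |G y| * |y - m| * (2 + |m|) := by ring
        _ ≤ _ := by gcongr; linarith
  refine ⟨?_, hdecay⟩
  obtain ⟨C, hC, hGC⟩ := hdecay
  exact ⟨C, fun y => (hGC y).trans (div_le_self hC.le (by linarith [abs_nonneg y]))⟩
end

section
/- Let A, B ∈ ℝ, T > 0, and define P₁(τ, x) = τ·(−A·∂³ₓₓₓ P₀ + (A + B)·∂²ₓₓ P₀ − B·∂ₓ P₀)(τ, x), where P₀(τ, x) = P_BS(τ, x; σ̄). Then P₁ is bounded on (0, T] × ℝ, and for every fixed x ∈ ℝ, P₁(τ, x) → 0 as τ → 0⁺. -/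
noncomputable section

/-- Standard normal cumulative distribution function
`N(z) = (1/√(2π)) ∫_{-∞}^z e^{-u²/2} du`. -/
def stdN (z : ℝ) : ℝ :=
  (Real.sqrt (2 * Real.pi))⁻¹ * ∫ u in Set.Iic z, Real.exp (-(u ^ 2) / 2)

/-- `d₁ = (x + σ²τ/2)/(σ√τ)`. -/
def d1 (σ τ x : ℝ) : ℝ := (x + σ ^ 2 * τ / 2) / (σ * Real.sqrt τ)

/-- `d₂ = (x - σ²τ/2)/(σ√τ)`. -/
def d2 (σ τ x : ℝ) : ℝ := (x - σ ^ 2 * τ / 2) / (σ * Real.sqrt τ)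

/-- Black–Scholes put price in log-moneyness variable `x = log(S/K)`,
as a function of time-to-maturity `τ`:
`P_BS(τ,x;σ) = K·N(-d₂) - K·eˣ·N(-d₁)`. -/
def PBS (K σ τ x : ℝ) : ℝ :=
  K * stdN (-(d2 σ τ x)) - K * Real.exp x * stdN (-(d1 σ τ x))

end

/-- The standard normal density. -/
noncomputable def stdGaussianDensity (z : ℝ) : ℝ :=
  (Real.sqrt (2 * Real.pi))⁻¹ * Real.exp (-(z ^ 2) / 2)

theorem hasDerivAt_stdN (z : ℝ) : HasDerivAt stdN (stdGaussianDensity z) z := by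
  have hint : MeasureTheory.Integrable (fun u : ℝ => Real.exp (-(u ^ 2) / 2)) := by
    convert integrable_exp_neg_mul_sq (b := 1 / 2) (by norm_num) using 2 with u
    ring_nf
  have hcont : Continuous (fun u : ℝ => Real.exp (-(u ^ 2) / 2)) := by fun_prop
  have hsplit : stdN = fun z : ℝ => (Real.sqrt (2 * Real.pi))⁻¹ *
      ((∫ u in (0 : ℝ)..z, Real.exp (-(u ^ 2) / 2)) +
        ∫ u in Set.Iic (0 : ℝ), Real.exp (-(u ^ 2) / 2)) := by
    funext z
    rw [← intervalIntegral.integral_Iic_sub_Iic hint.integrableOn hint.integrableOn,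
      sub_add_cancel, stdN]
  rw [hsplit]
  exact ((hcont.integral_hasStrictDerivAt 0 z).hasDerivAt.add_const _).const_mul _

theorem hasDerivAt_stdGaussianDensity (z : ℝ) :
    HasDerivAt stdGaussianDensity (-z * stdGaussianDensity z) z := by
  have h := ((((hasDerivAt_id z).pow 2).neg.div_const 2).exp).const_mul
    (Real.sqrt (2 * Real.pi))⁻¹
  refine h.congr_deriv ?_
  simp [stdGaussianDensity]
  ring

theorem stdGaussianDensity_nonneg (z : ℝ) : 0 ≤ stdGaussianDensity z := by
  unfold stdGaussianDensity
  positivity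

theorem inv_sqrt_two_pi_le_one : (Real.sqrt (2 * Real.pi))⁻¹ ≤ 1 := by
  refine inv_le_one_of_one_le₀ (Real.one_le_sqrt.2 ?_)
  linarith [Real.pi_gt_three]

theorem one_add_sq_half_mul_stdGaussianDensity_le_one (z : ℝ) :
    (1 + z ^ 2 / 2) * stdGaussianDensity z ≤ 1 := by
  have h1 : (1 + z ^ 2 / 2) * Real.exp (-(z ^ 2) / 2) ≤ 1 := by
    rw [neg_div, Real.exp_neg, ← div_eq_mul_inv, div_le_one (Real.exp_pos _)]
    linarith [Real.add_one_le_exp (z ^ 2 / 2)]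
  calc (1 + z ^ 2 / 2) * stdGaussianDensity z
      = (Real.sqrt (2 * Real.pi))⁻¹ * ((1 + z ^ 2 / 2) * Real.exp (-(z ^ 2) / 2)) := by
        unfold stdGaussianDensity; ring
    _ ≤ 1 := mul_le_one₀ inv_sqrt_two_pi_le_one (by positivity) h1

theorem stdGaussianDensity_le_one (z : ℝ) : stdGaussianDensity z ≤ 1 := by
  nlinarith [one_add_sq_half_mul_stdGaussianDensity_le_one z,
    mul_nonneg (sq_nonneg z) (stdGaussianDensity_nonneg z)]

theorem abs_mul_stdGaussianDensity_le_one (z : ℝ) : |z * stdGaussianDensity z| ≤ 1 := by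
  have h := one_add_sq_half_mul_stdGaussianDensity_le_one z
  have h0 := stdGaussianDensity_nonneg z
  rw [abs_mul, abs_of_nonneg h0]
  nlinarith [mul_nonneg (sq_nonneg (|z| - 1)) h0, sq_abs z]

theorem abs_mul_stdGaussianDensity_le_inv (z : ℝ) :
    |z * stdGaussianDensity z| ≤ 2 * |z⁻¹| := by
  rcases eq_or_ne z 0 with rfl | hz
  · simp
  have h := one_add_sq_half_mul_stdGaussianDensity_le_one z
  have h0 := stdGaussianDensity_nonneg z
  have hz' : 0 < |z| := abs_pos.2 hz
  rw [abs_mul, abs_of_nonneg h0, abs_inv, ← div_eq_mul_inv, le_div_iff₀ hz']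
  nlinarith [sq_abs z]

theorem hasDerivAt_d1 (σ τ x : ℝ) :
    HasDerivAt (d1 σ τ) (σ * Real.sqrt τ)⁻¹ x :=
  (((hasDerivAt_id x).add_const (σ ^ 2 * τ / 2)).div_const (σ * Real.sqrt τ)).congr_deriv
    (one_div _)

theorem hasDerivAt_d2 (σ τ x : ℝ) :
    HasDerivAt (d2 σ τ) (σ * Real.sqrt τ)⁻¹ x :=
  (((hasDerivAt_id x).sub_const (σ ^ 2 * τ / 2)).div_const (σ * Real.sqrt τ)).congr_deriv
    (one_div _)

section Greeks

variable {σ τ : ℝ}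

theorem exp_mul_stdGaussianDensity_d1 (hσ : 0 < σ) (hτ : 0 < τ) (x : ℝ) :
    Real.exp x * stdGaussianDensity (d1 σ τ x) = stdGaussianDensity (d2 σ τ x) := by
  have hs : Real.sqrt τ ^ 2 = τ := Real.sq_sqrt hτ.le
  have hs0 : Real.sqrt τ ≠ 0 := (Real.sqrt_pos.2 hτ).ne'
  have key : x + -(d1 σ τ x ^ 2) / 2 = -(d2 σ τ x ^ 2) / 2 := by
    unfold d1 d2
    rw [div_pow, div_pow, mul_pow, hs]
    field_simp
    ring
  unfold stdGaussianDensity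
  rw [← key, Real.exp_add]
  ring

theorem hasDerivAt_exp_mul_stdN_neg_d1 (hσ : 0 < σ) (hτ : 0 < τ) (x : ℝ) :
    HasDerivAt (fun y => Real.exp y * stdN (-(d1 σ τ y)))
      (Real.exp x * stdN (-(d1 σ τ x)) -
        stdGaussianDensity (d2 σ τ x) * (σ * Real.sqrt τ)⁻¹) x := by
  have h := (Real.hasDerivAt_exp x).mul
    ((hasDerivAt_stdN (-(d1 σ τ x))).comp x (hasDerivAt_d1 σ τ x).neg)
  refine h.congr_deriv ?_
  have hneg : stdGaussianDensity (-(d1 σ τ x)) = stdGaussianDensity (d1 σ τ x) := by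
    simp [stdGaussianDensity]
  rw [← exp_mul_stdGaussianDensity_d1 hσ hτ, hneg]
  simp only [Function.comp_apply, Pi.neg_apply]
  ring

theorem hasDerivAt_stdGaussianDensity_d2 (σ τ x : ℝ) :
    HasDerivAt (fun y => stdGaussianDensity (d2 σ τ y))
      (-(d2 σ τ x) * stdGaussianDensity (d2 σ τ x) * (σ * Real.sqrt τ)⁻¹) x :=
  (hasDerivAt_stdGaussianDensity (d2 σ τ x)).comp x (hasDerivAt_d2 σ τ x)

theorem deriv_PBS (hσ : 0 < σ) (hτ : 0 < τ) (K : ℝ) :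
    deriv (fun x => PBS K σ τ x) = fun x => -K * (Real.exp x * stdN (-(d1 σ τ x))) := by
  funext x
  have h := (((hasDerivAt_stdN (-(d2 σ τ x))).comp x (hasDerivAt_d2 σ τ x).neg).const_mul K).sub
    ((hasDerivAt_exp_mul_stdN_neg_d1 hσ hτ x).const_mul K)
  have hneg : stdGaussianDensity (-(d2 σ τ x)) = stdGaussianDensity (d2 σ τ x) := by
    simp [stdGaussianDensity]
  have h' : HasDerivAt (fun x => PBS K σ τ x)
      (-K * (Real.exp x * stdN (-(d1 σ τ x)))) x := by
    refine (h.congr_deriv ?_).congr_of_eventuallyEq (.of_forall fun y => ?_)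
    · rw [hneg]; ring
    · simp only [PBS, Pi.sub_apply, Function.comp_apply, Pi.neg_apply]; ring
  exact h'.deriv

theorem deriv_deriv_PBS (hσ : 0 < σ) (hτ : 0 < τ) (K : ℝ) :
    deriv (deriv (fun x => PBS K σ τ x)) = fun x =>
      -K * (Real.exp x * stdN (-(d1 σ τ x)) -
        stdGaussianDensity (d2 σ τ x) * (σ * Real.sqrt τ)⁻¹) := by
  rw [deriv_PBS hσ hτ]
  funext x
  exact ((hasDerivAt_exp_mul_stdN_neg_d1 hσ hτ x).const_mul (-K)).deriv

theorem deriv_deriv_deriv_PBS (hσ : 0 < σ) (hτ : 0 < τ) (K : ℝ) :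
    deriv (deriv (deriv (fun x => PBS K σ τ x))) = fun x =>
      -K * (Real.exp x * stdN (-(d1 σ τ x)) -
        stdGaussianDensity (d2 σ τ x) * (σ * Real.sqrt τ)⁻¹ -
        -(d2 σ τ x) * stdGaussianDensity (d2 σ τ x) * (σ * Real.sqrt τ)⁻¹ *
          (σ * Real.sqrt τ)⁻¹) := by
  rw [deriv_deriv_PBS hσ hτ]
  funext x
  exact (((hasDerivAt_exp_mul_stdN_neg_d1 hσ hτ x).sub
    ((hasDerivAt_stdGaussianDensity_d2 σ τ x).mul_const _)).const_mul (-K)).deriv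

/-- In the price correction the terms containing the normal distribution function cancel. -/
theorem price_correction_eq (hσ : 0 < σ) (hτ : 0 < τ) (K A B x : ℝ) :
    τ * (-A * deriv (deriv (deriv (fun x' => PBS K σ τ x'))) x
        + (A + B) * deriv (deriv (fun x' => PBS K σ τ x')) x
        - B * deriv (fun x' => PBS K σ τ x') x) =
      K * B / σ * (Real.sqrt τ * stdGaussianDensity (d2 σ τ x)) +
        K * A / σ ^ 2 * (d2 σ τ x * stdGaussianDensity (d2 σ τ x)) := by
  rw [deriv_deriv_deriv_PBS hσ hτ, deriv_deriv_PBS hσ hτ, deriv_PBS hσ hτ]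
  beta_reduce
  have hs : Real.sqrt τ ^ 2 = τ := Real.sq_sqrt hτ.le
  have hs0 : Real.sqrt τ ≠ 0 := (Real.sqrt_pos.2 hτ).ne'
  generalize stdGaussianDensity (d2 σ τ x) = g
  generalize d2 σ τ x = d
  generalize stdN (-(d1 σ τ x)) = n
  rw [← hs, Real.sqrt_sq (Real.sqrt_nonneg τ)]
  field_simp
  ring

theorem tendsto_sqrt_mul_stdGaussianDensity_d2 (σ x : ℝ) :
    Filter.Tendsto (fun τ => Real.sqrt τ * stdGaussianDensity (d2 σ τ x))
      (nhdsWithin 0 (Set.Ioi 0)) (nhds 0) := by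
  have hsqrt : Filter.Tendsto Real.sqrt (nhdsWithin 0 (Set.Ioi 0)) (nhds 0) := by
    simpa using (Real.continuous_sqrt.tendsto 0).mono_left nhdsWithin_le_nhds
  exact squeeze_zero
    (fun τ => mul_nonneg (Real.sqrt_nonneg τ) (stdGaussianDensity_nonneg _))
    (fun τ => mul_le_of_le_one_right (Real.sqrt_nonneg τ) (stdGaussianDensity_le_one _)) hsqrt

theorem tendsto_d2_mul_stdGaussianDensity_d2 (hσ : 0 < σ) (x : ℝ) :
    Filter.Tendsto (fun τ => d2 σ τ x * stdGaussianDensity (d2 σ τ x))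
      (nhdsWithin 0 (Set.Ioi 0)) (nhds 0) := by
  rcases eq_or_ne x 0 with rfl | hx
  · have hlim : Filter.Tendsto (fun τ => σ / 2 * Real.sqrt τ)
        (nhdsWithin 0 (Set.Ioi 0)) (nhds 0) := by
      have hc : Continuous fun τ : ℝ => σ / 2 * Real.sqrt τ := by fun_prop
      simpa using (hc.tendsto 0).mono_left nhdsWithin_le_nhds
    refine squeeze_zero_norm' ?_ hlim
    filter_upwards [self_mem_nhdsWithin] with τ (hτ : 0 < τ)
    have hs : Real.sqrt τ ^ 2 = τ := Real.sq_sqrt hτ.le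
    have hs0 : Real.sqrt τ ≠ 0 := (Real.sqrt_pos.2 hτ).ne'
    have hd : d2 σ τ 0 = -(σ / 2 * Real.sqrt τ) := by
      unfold d2
      field_simp
      rw [hs]
      ring
    have hnn : 0 ≤ σ / 2 * Real.sqrt τ := by positivity
    rw [Real.norm_eq_abs, abs_mul, abs_of_nonneg (stdGaussianDensity_nonneg _)]
    refine (mul_le_of_le_one_right (abs_nonneg _) (stdGaussianDensity_le_one _)).trans_eq ?_
    rw [hd, abs_neg, abs_of_nonneg hnn]
  · have hinv : Filter.Tendsto (fun τ => (d2 σ τ x)⁻¹)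
        (nhdsWithin 0 (Set.Ioi 0)) (nhds 0) := by
      have hc : ContinuousAt (fun τ => (d2 σ τ x)⁻¹) 0 := by
        simp only [d2, inv_div]
        exact ContinuousAt.div (by fun_prop) (by fun_prop) (by simpa using hx)
      simpa [d2] using hc.tendsto.mono_left nhdsWithin_le_nhds
    refine squeeze_zero_norm (fun τ => abs_mul_stdGaussianDensity_le_inv _) ?_
    simpa using hinv.abs.const_mul 2

end Greeks

/-- the price correction `P₁` is bounded on `(0,T] × ℝ`, and
`P₁(τ,x) → 0` as `τ → 0⁺` for every fixed `x`. -/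
theorem P1_bounded_and_vanishes (σb K A B T : ℝ) (hσ : 0 < σb) (hK : 0 < K) (hT : 0 < T) :
    (∃ M : ℝ, ∀ τ ∈ Set.Ioc (0:ℝ) T, ∀ x : ℝ,
      |τ * (-A * deriv (deriv (deriv (fun x' => PBS K σb τ x'))) x
            + (A + B) * deriv (deriv (fun x' => PBS K σb τ x')) x
            - B * deriv (fun x' => PBS K σb τ x') x)| ≤ M) ∧
    ∀ x : ℝ,
      Filter.Tendsto
        (fun τ => τ * (-A * deriv (deriv (deriv (fun x' => PBS K σb τ x'))) x
            + (A + B) * deriv (deriv (fun x' => PBS K σb τ x')) x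
            - B * deriv (fun x' => PBS K σb τ x') x))
        (nhdsWithin 0 (Set.Ioi 0)) (nhds 0) := by
  refine ⟨⟨|K * B / σb| * Real.sqrt T + |K * A / σb ^ 2|, ?_⟩, fun x => ?_⟩
  · rintro τ ⟨hτ, hτT⟩ x
    rw [price_correction_eq hσ hτ]
    refine (abs_add_le _ _).trans (add_le_add ?_ ?_)
    · rw [abs_mul]
      refine mul_le_mul_of_nonneg_left ?_ (abs_nonneg _)
      rw [abs_of_nonneg (mul_nonneg (Real.sqrt_nonneg τ) (stdGaussianDensity_nonneg _))]
      exact (mul_le_of_le_one_right (Real.sqrt_nonneg τ)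
        (stdGaussianDensity_le_one _)).trans (Real.sqrt_le_sqrt hτT)
    · rw [abs_mul]
      exact mul_le_of_le_one_right (abs_nonneg _) (abs_mul_stdGaussianDensity_le_one _)
  · have h := ((tendsto_sqrt_mul_stdGaussianDensity_d2 σb x).const_mul (K * B / σb)).add
      ((tendsto_d2_mul_stdGaussianDensity_d2 hσ x).const_mul (K * A / σb ^ 2))
    simp only [mul_zero, add_zero] at h
    refine h.congr' ?_
    filter_upwards [self_mem_nhdsWithin] with τ (hτ : 0 < τ)
    exact (price_correction_eq hσ hτ K A B x).symm
end
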